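/- If s ≥ 0 satisfies s·η_f ≥ 6 (in particular η_f > 0), then g₀(s) = 1. Consequently sup { s ≥ 0 : g₀(s) < 1 } ≤ 6/η_f whenever η_f > 0. -/

import Mathlib

open MeasureTheory Set Filter

/-- Hypotheses on the function `f₁` from Section 6.1 of the paper. -/
structure F1Hyp (ℓ ℓ₁ : ℝ) (f₁ : ℝ → ℝ) : Prop where
  hl : 0 < ℓ
  hl1 : 0 < ℓ₁
  cont : ContinuousOn f₁ (Icc 0 1)
  diff : ∃ d : ℝ → ℝ, ContinuousOn d (Ioc 0 1) ∧
    ∀ t ∈ Ioc (0:ℝ) 1, HasDerivWithinAt f₁ (d t) (Ioc 0 1) t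
  anti : StrictAntiOn f₁ (Icc 0 1)
  nonneg : ∀ t ∈ Icc (0:ℝ) 1, 0 ≤ f₁ t
  f10 : f₁ 0 = ℓ
  f11 : f₁ 1 = 0
  convexSqrt : ConvexOn ℝ (Icc 0 1) (fun u => f₁ (Real.sqrt u))
  lim0 : Tendsto (fun s => (f₁ s - ℓ + ℓ₁ * s) / s) (nhdsWithin 0 (Ioi 0)) (nhds 0)

/-- `γ` is admissible, with a.e. derivative `γ'` (absolute continuity is encoded by the
fundamental theorem of calculus representation with an `L¹` derivative). -/
def Admissible (γ γ' : ℝ → ℝ) : Prop :=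
  IntegrableOn γ' (Icc 0 1) ∧
  (∀ t ∈ Icc (0:ℝ) 1, γ t = ∫ u in (0:ℝ)..t, γ' u) ∧
  (∀ t ∈ Icc (0:ℝ) 1, 0 ≤ γ t ∧ γ t ≤ 1) ∧
  γ 0 = 0 ∧ γ 1 = 0

/-- The energy in the characterization (6.11). -/
noncomputable def energy (f₁ : ℝ → ℝ) (s : ℝ) (γ γ' : ℝ → ℝ) : ℝ :=
  ∫ t in (0:ℝ)..1, Real.sqrt (s ^ 2 * (f₁ (Real.sqrt (γ t))) ^ 2 + (γ' t) ^ 2 / 4)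

/-- The cohesive energy density of pristine material, via characterization (6.11). -/
noncomputable def g0 (f₁ : ℝ → ℝ) (s : ℝ) : ℝ :=
  sInf {x | ∃ γ γ' : ℝ → ℝ, Admissible γ γ' ∧ x = energy f₁ s γ γ'}


/-- `η_f := liminf_{t→1⁻} f₁(t)/(1−t²)`, as an element of `[0,∞]`. -/
noncomputable def etaF (f₁ : ℝ → ℝ) : ENNReal :=
  Filter.liminf (fun t => ENNReal.ofReal (f₁ t / (1 - t ^ 2))) (nhdsWithin 1 (Iio 1))


lemma sqrt_mem_aux {u : ℝ} (hu : u ∈ Icc (0:ℝ) 1) : Real.sqrt u ∈ Icc (0:ℝ) 1 :=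
  ⟨Real.sqrt_nonneg _, Real.sqrt_le_one.mpr hu.2⟩

/-- Key lower bound on `f₁` from convexity. -/
lemma key_lower {ℓ ℓ₁ : ℝ} {f₁ : ℝ → ℝ} (hf : F1Hyp ℓ ℓ₁ f₁) {s : ℝ} (hs : 0 ≤ s)
    (h6 : (6 : ENNReal) ≤ ENNReal.ofReal s * etaF f₁) {u : ℝ} (hu : u ∈ Icc (0:ℝ) 1) :
    6 * (1 - u) ≤ s * f₁ (Real.sqrt u) := by
  rcases eq_or_lt_of_le hu.2 with h1 | h1
  · subst h1; simp [hf.f11]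
  have hη : etaF f₁ ≤ ENNReal.ofReal (f₁ (Real.sqrt u) / (1 - u)) := by
    unfold etaF
    apply liminf_le_of_frequently_le'
    apply Eventually.frequently
    have hsq : Real.sqrt u < 1 := by
      rw [Real.sqrt_lt' one_pos]; simpa using h1
    filter_upwards [Ioo_mem_nhdsLT hsq] with t ht
    apply ENNReal.ofReal_le_ofReal
    have ht0 : 0 ≤ t := (Real.sqrt_nonneg u).trans ht.1.le
    have hut : u < t ^ 2 := (Real.sqrt_lt' (lt_of_le_of_lt (Real.sqrt_nonneg u) ht.1)).1 ht.1
    have ht1 : t ^ 2 < 1 := by have := ht.2; nlinarith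
    have := hf.convexSqrt.secant_mono_aux1 hu (right_mem_Icc.2 zero_le_one) hut ht1
    simp only [Real.sqrt_sq ht0, Real.sqrt_one, hf.f11] at this
    rw [div_le_div_iff₀ (by linarith) (by linarith)]
    linarith
  have h7 := h6.trans (mul_le_mul_right hη (ENNReal.ofReal s))
  rw [← ENNReal.ofReal_mul hs] at h7
  have h8 : ENNReal.ofReal 6 ≤ ENNReal.ofReal (s * (f₁ (Real.sqrt u) / (1 - u))) := by
    simpa using h7
  have hnn : 0 ≤ s * (f₁ (Real.sqrt u) / (1 - u)) :=
    mul_nonneg hs (div_nonneg (hf.nonneg _ (sqrt_mem_aux hu)) (by linarith))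
  have h9 := (ENNReal.ofReal_le_ofReal_iff hnn).1 h8
  have h10 : 0 < 1 - u := by linarith
  rw [← mul_div_assoc, le_div_iff₀ h10] at h9
  exact h9

lemma key_upper {ℓ ℓ₁ : ℝ} {f₁ : ℝ → ℝ} (hf : F1Hyp ℓ ℓ₁ f₁) {u : ℝ} (hu : u ∈ Icc (0:ℝ) 1) :
    f₁ (Real.sqrt u) ≤ ℓ * (1 - u) := by
  have hw : 0 ≤ 1 - u := by linarith [hu.2]
  have := hf.convexSqrt.2 (left_mem_Icc.2 (zero_le_one' ℝ)) (right_mem_Icc.2 (zero_le_one' ℝ))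
    hw hu.1 (by ring)
  simp only [smul_eq_mul, mul_zero, mul_one, zero_add, Real.sqrt_zero, Real.sqrt_one, hf.f10,
    hf.f11, add_zero] at this
  linarith

lemma sqrt_add_le_aux {a b : ℝ} (ha : 0 ≤ a) :
    Real.sqrt (a ^ 2 + b ^ 2 / 4) ≤ a + |b| / 2 := by
  have hb := abs_nonneg b
  apply Real.sqrt_le_iff.2 ⟨by positivity, ?_⟩
  have := sq_abs b
  nlinarith [mul_nonneg ha hb]

lemma gamma_cont {γ γ' : ℝ → ℝ} (h : Admissible γ γ') : ContinuousOn γ (Icc 0 1) := by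
  have h1 : ContinuousOn (fun t => ∫ u in (0:ℝ)..t, γ' u) (Icc 0 1) :=
by
    have h2 : IntegrableOn γ' (uIcc 0 1) := by
      rw [uIcc_of_le (zero_le_one' ℝ)]; exact h.1
    have h3 := intervalIntegral.continuousOn_primitive_interval h2
    rwa [uIcc_of_le (zero_le_one' ℝ)] at h3
  exact h1.congr h.2.1

lemma energy_integrable {ℓ ℓ₁ : ℝ} {f₁ : ℝ → ℝ} (hf : F1Hyp ℓ ℓ₁ f₁) {s : ℝ} (hs : 0 ≤ s)
    {γ γ' : ℝ → ℝ} (h : Admissible γ γ') :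
    IntervalIntegrable (fun t => Real.sqrt (s ^ 2 * (f₁ (Real.sqrt (γ t))) ^ 2 + (γ' t) ^ 2 / 4))
      volume 0 1 := by
  rw [intervalIntegrable_iff_integrableOn_Icc_of_le zero_le_one]
  have hc : ContinuousOn (fun t => f₁ (Real.sqrt (γ t))) (Icc 0 1) := by
    apply hf.cont.comp (gamma_cont h).sqrt
    intro t ht
    exact sqrt_mem_aux (h.2.2.1 t ht)
  have hi : IntegrableOn (fun t => s * f₁ (Real.sqrt (γ t)) + |γ' t| / 2) (Icc 0 1) := by
    apply Integrable.add
    · exact (hc.const_smul s).integrableOn_Icc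
    · exact h.1.abs.div_const 2
  refine Integrable.mono' hi ?_ ?_
  · have m1 : AEMeasurable (fun t => f₁ (Real.sqrt (γ t))) (volume.restrict (Icc 0 1)) :=
      hc.aemeasurable measurableSet_Icc
    have m2 : AEMeasurable γ' (volume.restrict (Icc 0 1)) := h.1.aemeasurable
    exact (((m1.pow_const 2).const_mul (s ^ 2)).add ((m2.pow_const 2).div_const 4)).sqrt.aestronglyMeasurable
  · rw [ae_restrict_iff' measurableSet_Icc]
    refine ae_of_all _ fun t ht => ?_
    rw [Real.norm_of_nonneg (Real.sqrt_nonneg _), ← mul_pow]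
    exact sqrt_add_le_aux (mul_nonneg hs (hf.nonneg _ (sqrt_mem_aux (h.2.2.1 t ht))))

lemma parts_aux {γ γ' : ℝ → ℝ} (h : Admissible γ γ') :
    ∫ t in (0:ℝ)..1, (γ' t / 2 * Real.cos (Real.pi * t)
      + Real.pi / 2 * (1 - γ t) * Real.sin (Real.pi * t)) = 1 := by
  set G : ℝ → ℝ := fun t => ∫ u in (0:ℝ)..t, γ' u with hG
  have hint : IntervalIntegrable γ' volume 0 1 := by
    rw [intervalIntegrable_iff_integrableOn_Icc_of_le zero_le_one]; exact h.1
  have hGac : AbsolutelyContinuousOnInterval G 0 1 :=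
    hint.absolutelyContinuousOnInterval_intervalIntegral (by simp)
  have hd : ∀ t, HasDerivAt (fun t : ℝ => Real.cos (Real.pi * t))
      (-Real.sin (Real.pi * t) * (Real.pi)) t := by
    intro t
    have := ((hasDerivAt_id t).const_mul Real.pi).cos
    simpa using this
  have hcac : AbsolutelyContinuousOnInterval (fun t : ℝ => Real.cos (Real.pi * t)) 0 1 := by
    apply ContDiffOn.absolutelyContinuousOnInterval
    apply ContDiff.contDiffOn
    fun_prop
  have key := hGac.integral_deriv_mul_eq_sub hcac
  have hG1 : G 1 = 0 := by
    exact (h.2.1 1 (by simp)).symm.trans h.2.2.2.2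
  have hG0 : G 0 = 0 := by simp [hG]
  simp only [hG0, hG1, zero_mul, sub_zero] at key
  have hsin : ∫ t in (0:ℝ)..1, Real.pi / 2 * Real.sin (Real.pi * t) = 1 := by
    have : ∀ t ∈ uIcc (0:ℝ) 1, HasDerivAt (fun t : ℝ => -(1/2) * Real.cos (Real.pi * t))
      (Real.pi / 2 * Real.sin (Real.pi * t)) t := by
      intro t _
      exact ((hd t).const_mul (-(1/2))).congr_deriv (by ring)
    rw [intervalIntegral.integral_eq_sub_of_hasDerivAt this
      (Continuous.intervalIntegrable (by fun_prop) _ _)]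
    norm_num
  have hi1 : IntervalIntegrable (fun x => deriv G x * Real.cos (Real.pi * x)
      + G x * deriv (fun t : ℝ => Real.cos (Real.pi * t)) x) volume 0 1 :=
    (hGac.intervalIntegrable_deriv.mul_continuousOn hcac.continuousOn).add
      (hcac.intervalIntegrable_deriv.continuousOn_mul hGac.continuousOn)
  calc _ = ∫ t in (0:ℝ)..1, ((1/2) * (deriv G t * Real.cos (Real.pi * t)
      + G t * deriv (fun t : ℝ => Real.cos (Real.pi * t)) t)
        + Real.pi / 2 * Real.sin (Real.pi * t)) := by
        apply intervalIntegral.integral_congr_ae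
        filter_upwards [hint.ae_hasDerivAt_integral] with t ht hmem
        have hm : t ∈ uIcc (0:ℝ) 1 := uIoc_subset_uIcc hmem
        have h1 : deriv G t = γ' t := (ht hm 0 (by simp)).deriv
        have h2 : γ t = G t := h.2.1 t (by simpa [uIcc_of_le] using hm)
        rw [h1, h2, (hd t).deriv]
        ring
    _ = 1 := by
        rw [intervalIntegral.integral_add (hi1.const_mul _)
          (Continuous.intervalIntegrable (by fun_prop) _ _),
          intervalIntegral.integral_const_mul, key, hsin]
        simp

lemma energy_ge {ℓ ℓ₁ : ℝ} {f₁ : ℝ → ℝ} (hf : F1Hyp ℓ ℓ₁ f₁) {s : ℝ} (hs : 0 ≤ s)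
    (h6 : (6 : ENNReal) ≤ ENNReal.ofReal s * etaF f₁)
    {γ γ' : ℝ → ℝ} (h : Admissible γ γ') : 1 ≤ energy f₁ s γ γ' := by
  rw [← parts_aux h]
  unfold energy
  have hint : IntervalIntegrable γ' volume 0 1 := by
    rw [intervalIntegrable_iff_integrableOn_Icc_of_le zero_le_one]; exact h.1
  have hgc : ContinuousOn γ (uIcc 0 1) := by simpa [uIcc_of_le] using gamma_cont h
  apply intervalIntegral.integral_mono_on zero_le_one ?_ (energy_integrable hf hs h)
  · intro t ht
    have hg := h.2.2.1 t ht
    have hk := key_lower hf hs h6 (u := γ t) hg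
    have hpi := Real.pi_lt_four
    have hpi0 := Real.pi_pos
    have hcs := Real.sin_sq_add_cos_sq (Real.pi * t)
    set c := Real.cos (Real.pi * t)
    set d := Real.sin (Real.pi * t)
    have hA : Real.pi / 2 * (1 - γ t) ≤ s * f₁ (Real.sqrt (γ t)) := by
      nlinarith [hg.2]
    have hA0 : 0 ≤ Real.pi / 2 * (1 - γ t) := mul_nonneg (by positivity) (by linarith [hg.2])
    set A := Real.pi / 2 * (1 - γ t)
    set B := s * f₁ (Real.sqrt (γ t))
    rw [← mul_pow]
    apply Real.le_sqrt_of_sq_le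
    have : A ^ 2 ≤ B ^ 2 := by gcongr
    have h3 : (γ' t / 2 * c + A * d) ^ 2 + (γ' t / 2 * d - A * c) ^ 2
        = ((γ' t) ^ 2 / 4 + A ^ 2) * (d ^ 2 + c ^ 2) := by ring
    rw [hcs] at h3
    nlinarith [sq_nonneg (γ' t / 2 * d - A * c)]
  · apply IntervalIntegrable.add
    · exact (hint.div_const 2).mul_continuousOn (by fun_prop)
    · apply ContinuousOn.intervalIntegrable
      fun_prop

/-- competitors -/
lemma competitor {ℓ ℓ₁ : ℝ} {f₁ : ℝ → ℝ} (hf : F1Hyp ℓ ℓ₁ f₁) {s : ℝ} (hs : 0 ≤ s) (n : ℕ) :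
    ∃ γ γ' : ℝ → ℝ, Admissible γ γ' ∧ energy f₁ s γ γ' ≤ 1 + s * ℓ / (2 * n + 3) := by
  set γ : ℝ → ℝ := fun t => 1 - (2 * t - 1) ^ (2 * n + 2) with hγ
  set γ' : ℝ → ℝ := fun t => -((2 * n + 2) * 2) * (2 * t - 1) ^ (2 * n + 1) with hγ'
  have hd : ∀ t, HasDerivAt γ (γ' t) t := by
    intro t
    have h1 : HasDerivAt (fun t : ℝ => 2 * t - 1) 2 t := by
      simpa using ((hasDerivAt_id t).const_mul 2).sub_const 1
    have := (h1.pow (2 * n + 2)).const_sub 1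
    refine this.congr_deriv ?_
    simp only [hγ', Nat.add_sub_cancel, Nat.cast_add, Nat.cast_mul, Nat.cast_ofNat,
      show 2 * n + 2 - 1 = 2 * n + 1 from rfl]
    ring
  have hc' : Continuous γ' := by fun_prop
  have hc : Continuous γ := by fun_prop
  have hftc : ∀ a b : ℝ, ∫ u in a..b, γ' u = γ b - γ a := fun a b =>
    intervalIntegral.integral_eq_sub_of_hasDerivAt (fun x _ => hd x) (hc'.intervalIntegrable _ _)
  have hev : Even (2 * n + 2) := ⟨n + 1, by ring⟩
  have h0 : γ 0 = 0 := by simp [hγ, hev.neg_one_pow]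
  have h1 : γ 1 = 0 := by norm_num [hγ]
  have h2 : γ (1/2) = 1 := by norm_num [hγ]
  have hadm : Admissible γ γ' := by
    refine ⟨hc'.integrableOn_Icc, fun t _ => by rw [hftc, h0, sub_zero], fun t ht => ?_, h0, h1⟩
    have hp : 0 ≤ (2 * t - 1) ^ (2 * n + 2) := hev.pow_nonneg _
    have hq : (2 * t - 1) ^ (2 * n + 2) ≤ 1 := by
      rw [← hev.pow_abs]
      exact pow_le_one₀ (abs_nonneg _) (abs_le.2 ⟨by linarith [ht.1], by linarith [ht.2]⟩)
    constructor <;> simp only [hγ] <;> linarith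
  refine ⟨γ, γ', hadm, ?_⟩
  have habs : ∫ t in (0:ℝ)..1, |γ' t| = 2 := by
    rw [← intervalIntegral.integral_add_adjacent_intervals (b := 1/2)
      (hc'.abs.intervalIntegrable _ _) (hc'.abs.intervalIntegrable _ _)]
    have e1 : ∫ t in (0:ℝ)..(1/2), |γ' t| = ∫ t in (0:ℝ)..(1/2), γ' t := by
      apply intervalIntegral.integral_congr
      intro t ht
      rw [uIcc_of_le (by norm_num)] at ht
      apply abs_of_nonneg
      have : (2 * t - 1) ^ (2 * n + 1) ≤ 0 :=
        Odd.pow_nonpos ⟨n, rfl⟩ (by linarith [ht.2])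
      simp only [hγ']
      apply mul_nonneg_of_nonpos_of_nonpos _ this
      have : (0:ℝ) ≤ n := Nat.cast_nonneg n
      linarith
    have e2 : ∫ t in (1/2:ℝ)..1, |γ' t| = ∫ t in (1/2:ℝ)..1, -γ' t := by
      apply intervalIntegral.integral_congr
      intro t ht
      rw [uIcc_of_le (by norm_num)] at ht
      apply abs_of_nonpos
      have : 0 ≤ (2 * t - 1) ^ (2 * n + 1) :=
        pow_nonneg (by linarith [ht.1]) _
      simp only [hγ']
      apply mul_nonpos_of_nonpos_of_nonneg _ this
      have : (0:ℝ) ≤ n := Nat.cast_nonneg n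
      linarith
    rw [e1, e2, intervalIntegral.integral_neg, hftc, hftc, h0, h1, h2]
    norm_num
  have hpow : ∫ t in (0:ℝ)..1, (1 - γ t) = 1 / (2 * n + 3) := by
    have hd2 : ∀ t ∈ uIcc (0:ℝ) 1,
        HasDerivAt (fun t : ℝ => (2 * t - 1) ^ (2 * n + 3) / (2 * (2 * n + 3))) (1 - γ t) t := by
      intro t _
      have h1 : HasDerivAt (fun t : ℝ => 2 * t - 1) 2 t := by
        simpa using ((hasDerivAt_id t).const_mul 2).sub_const 1
      have := (h1.pow (2 * n + 3)).div_const (2 * (2 * n + 3) : ℝ)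
      refine this.congr_deriv ?_
      have : (2 * n + 3 : ℝ) ≠ 0 := by positivity
      simp only [hγ, Nat.cast_add, Nat.cast_mul, Nat.cast_ofNat,
        show 2 * n + 3 - 1 = 2 * n + 2 from rfl]
      field_simp
      ring
    rw [intervalIntegral.integral_eq_sub_of_hasDerivAt hd2
      ((continuous_const.sub hc).intervalIntegrable _ _)]
    have : (-1:ℝ) ^ (2 * n + 3) = -1 := Odd.neg_one_pow ⟨n + 1, by ring⟩
    have h3 : (2 * n + 3 : ℝ) ≠ 0 := by positivity
    norm_num [this]
    field_simp
    norm_num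
  calc energy f₁ s γ γ' ≤ ∫ t in (0:ℝ)..1, (s * ℓ * (1 - γ t) + |γ' t| / 2) := by
        apply intervalIntegral.integral_mono_on zero_le_one (energy_integrable hf hs hadm)
        · exact Continuous.intervalIntegrable (by fun_prop) _ _
        · intro t ht
          have hg := hadm.2.2.1 t ht
          rw [← mul_pow]
          refine (sqrt_add_le_aux (mul_nonneg hs (hf.nonneg _ (sqrt_mem_aux hg)))).trans ?_
          rw [mul_assoc]
          gcongr
          exact key_upper hf hg
    _ = 1 + s * ℓ / (2 * n + 3) := by
        rw [intervalIntegral.integral_add (Continuous.intervalIntegrable (by fun_prop) _ _)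
          (Continuous.intervalIntegrable (by fun_prop) _ _),
          intervalIntegral.integral_const_mul, intervalIntegral.integral_div, habs, hpow]
        ring

lemma g0_eq_one {ℓ ℓ₁ : ℝ} {f₁ : ℝ → ℝ} (hf : F1Hyp ℓ ℓ₁ f₁) {s : ℝ} (hs : 0 ≤ s)
    (h6 : (6 : ENNReal) ≤ ENNReal.ofReal s * etaF f₁) : g0 f₁ s = 1 := by
  have hlb : ∀ x ∈ {x | ∃ γ γ' : ℝ → ℝ, Admissible γ γ' ∧ x = energy f₁ s γ γ'}, 1 ≤ x := by
    rintro x ⟨γ, γ', h, rfl⟩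
    exact energy_ge hf hs h6 h
  unfold g0
  apply le_antisymm
  · have hle : ∀ n : ℕ, sInf {x | ∃ γ γ' : ℝ → ℝ, Admissible γ γ' ∧ x = energy f₁ s γ γ'}
        ≤ 1 + s * ℓ / (2 * n + 3) := by
      intro n
      obtain ⟨γ, γ', h, he⟩ := competitor hf hs n
      exact (csInf_le ⟨1, hlb⟩ ⟨γ, γ', h, rfl⟩).trans he
    have ht : Tendsto (fun n : ℕ => 1 + s * ℓ / (2 * (n:ℝ) + 3)) atTop (nhds (1 + 0)) := by
      apply tendsto_const_nhds.add
      apply tendsto_const_nhds.div_atTop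
      apply tendsto_atTop_add_const_right
      exact tendsto_natCast_atTop_atTop.const_mul_atTop (by norm_num)
    rw [add_zero] at ht
    exact ge_of_tendsto' ht hle
  · obtain ⟨γ, γ', h, he⟩ := competitor hf hs 0
    exact le_csInf ⟨_, γ, γ', h, rfl⟩ hlb

/-- if `s ≥ 0` satisfies `s η_f ≥ 6` then `g₀(s) = 1`; consequently
`sup { s ≥ 0 : g₀(s) < 1 } ≤ 6/η_f` whenever `η_f > 0`. -/
theorem stmt_7 (ℓ ℓ₁ : ℝ) (f₁ : ℝ → ℝ) (hf : F1Hyp ℓ ℓ₁ f₁) :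
    (∀ s : ℝ, 0 ≤ s → (6 : ENNReal) ≤ ENNReal.ofReal s * etaF f₁ → g0 f₁ s = 1) ∧
    (0 < etaF f₁ →
      sSup {s : ℝ | 0 ≤ s ∧ g0 f₁ s < 1} ≤ ((6 : ENNReal) / etaF f₁).toReal) := by
  refine ⟨fun s hs h6 => g0_eq_one hf hs h6, fun hη => ?_⟩
  apply Real.sSup_le _ ENNReal.toReal_nonneg
  rintro s ⟨hs, hlt⟩
  have hn : ENNReal.ofReal s * etaF f₁ < 6 := by
    by_contra hcon
    exact hlt.ne (g0_eq_one hf hs (not_lt.1 hcon))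
  have h1 : ENNReal.ofReal s ≤ 6 / etaF f₁ := by
    apply ENNReal.le_div_iff_mul_le (Or.inl hη.ne') (Or.inr (by simp)) |>.2 hn.le
  exact (ENNReal.ofReal_le_iff_le_toReal (ENNReal.div_ne_top (by simp) hη.ne')).1 h1
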